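/- arXiv:2409.04924 — 2 statements merged into one kernel-verified Lean document; each statement's English description precedes it below -/
import Mathlib

section
/- For any β > 0, the equation τ²δ = ρ + E[(prox(τ̃H; λ₁τ̃/β))²] in the unknown τ > 0, where τ̃ = 1/(1/τ + 2λ₂/β) and H ~ N(0,1), admits a unique solution τ*(β). Moreover τ*(β) is the unique minimizer of τ ↦ ψ(τ,β) over τ ≥ 0, and the map β ↦ τ*(β) is continuously differentiable on (0,∞). -/
open MeasureTheory ProbabilityTheory Real Filter Topology

noncomputable section

/-- The proximal operator `prox(y; t)` with box constraint `|x| ≤ √P`. -/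
def prox (P y t : ℝ) : ℝ :=
  if t + Real.sqrt P ≤ y then Real.sqrt P
  else if t ≤ y then y - t
  else if -t ≤ y then 0
  else if -t - Real.sqrt P ≤ y then y + t
  else -Real.sqrt P

/-- Expectation with respect to a standard Gaussian random variable. -/
def gaussExp (f : ℝ → ℝ) : ℝ := ∫ h, f h ∂(gaussianReal 0 1)

/-- `τ̃ = 1/(1/τ + 2λ₂/β)`. -/
def tauTilde (lam2 τ β : ℝ) : ℝ := 1 / (1 / τ + 2 * lam2 / β)

/-- The fixed-point system characterizing `(τ*, β*)`. -/
def FixedPoint (δ ρ P lam1 lam2 τ β : ℝ) : Prop :=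
  τ ^ 2 * δ = ρ + gaussExp (fun h =>
      (prox P (tauTilde lam2 τ β * h) (lam1 * tauTilde lam2 τ β / β)) ^ 2) ∧
  β = 2 * τ * δ - 2 * gaussExp (fun h =>
      h * prox P (tauTilde lam2 τ β * h) (lam1 * tauTilde lam2 τ β / β))

/-- `ψ(τ, β)`. -/
def psi (δ ρ P lam1 lam2 τ β : ℝ) : ℝ :=
  β * τ * δ / 2 - β ^ 2 / 4 + β * ρ / (2 * τ) +
    gaussExp (fun h => sInf ((fun x => β / (2 * τ) * x ^ 2 + lam2 * x ^ 2 - β * h * x + lam1 * |x|) ''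
      Set.Icc (-Real.sqrt P) (Real.sqrt P)))

/-- The inner minimum value `min_{τ > 0} ψ(τ, β)`. -/
def minVal (δ ρ P lam1 lam2 β : ℝ) : ℝ :=
  sInf ((fun τ => psi δ ρ P lam1 lam2 τ β) '' Set.Ioi 0)

end

noncomputable section

/-- The square of the projection of `u` onto `[0, r]`. -/
def clipSq (r u : ℝ) : ℝ := (min (max u 0) r) ^ 2

/-- The derivative of `clipSq r` away from the kink at `r`. -/
def clipSqDeriv (r u : ℝ) : ℝ := if 0 < u ∧ u < r then 2 * u else 0

/-- The Gaussian expectation of `clipSq r (s * h - t)`, as a function of `(s, t)`. -/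
def clipMoment (r : ℝ) (p : ℝ × ℝ) : ℝ :=
  ∫ h, clipSq r (p.1 * h - p.2) ∂(gaussianReal 0 1)

lemma abs_prox (P y : ℝ) {t : ℝ} (ht : 0 ≤ t) :
    |prox P y t| = min (max (|y| - t) 0) √P := by
  have hr := Real.sqrt_nonneg P
  unfold prox
  split_ifs <;> grind

lemma prox_sq (P y : ℝ) {t : ℝ} (ht : 0 ≤ t) :
    prox P y t ^ 2 = clipSq √P (y - t) + clipSq √P (-y - t) := by
  have hr := Real.sqrt_nonneg P
  rw [← sq_abs, abs_prox P y ht, clipSq, clipSq]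
  rcases le_total 0 y with hy | hy
  · rw [abs_of_nonneg hy, max_eq_right (show -y - t ≤ 0 by linarith), min_eq_left hr]; ring
  · rw [abs_of_nonpos hy, max_eq_right (show y - t ≤ 0 by linarith), min_eq_left hr]; ring

/-- `prox P y t` attains the minimum that defines the proximal operator. -/
lemma prox_le (P y : ℝ) {t x : ℝ} (ht : 0 ≤ t) (hx : |x| ≤ √P) :
    prox P y t ^ 2 / 2 - y * prox P y t + t * |prox P y t| ≤ x ^ 2 / 2 - y * x + t * |x| := by
  have hr := Real.sqrt_nonneg P
  have hx' := abs_le.1 hx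
  have h1 : t * x ≤ t * |x| := mul_le_mul_of_nonneg_left (le_abs_self x) ht
  have h2 : t * (-x) ≤ t * |x| := mul_le_mul_of_nonneg_left (neg_le_abs x) ht
  unfold prox
  split_ifs with h h' h'' h'''
  · rw [abs_of_nonneg hr]
    nlinarith [mul_nonneg (sub_nonneg.2 h) (sub_nonneg.2 hx'.2), sq_nonneg (√P - x)]
  · rw [abs_of_nonneg (sub_nonneg.2 h')]
    nlinarith [sq_nonneg (y - t - x)]
  · simp only [abs_zero]
    rcases le_total 0 x with hx0 | hx0
    · rw [abs_of_nonneg hx0]; nlinarith [sq_nonneg x]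
    · rw [abs_of_nonpos hx0]; nlinarith [sq_nonneg x]
  · rw [abs_of_nonpos (by linarith)]
    nlinarith [sq_nonneg (y + t - x)]
  · rw [abs_neg, abs_of_nonneg hr]
    nlinarith [mul_nonneg (sub_nonneg.2 (not_le.1 h''').le) (neg_le_iff_add_nonneg.1 hx'.1),
      sq_nonneg (√P + x)]

lemma abs_prox_le (P y : ℝ) {t : ℝ} (ht : 0 ≤ t) : |prox P y t| ≤ √P := by
  rw [abs_prox P y ht]; exact min_le_right _ _

lemma measurable_prox (P t : ℝ) : Measurable (fun y => prox P y t) := by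
  unfold prox
  refine Measurable.ite measurableSet_Ici measurable_const ?_
  refine Measurable.ite measurableSet_Ici (by fun_prop) ?_
  refine Measurable.ite measurableSet_Ici measurable_const ?_
  exact Measurable.ite measurableSet_Ici (by fun_prop) measurable_const

lemma clipSq_nonneg (r u : ℝ) : 0 ≤ clipSq r u := sq_nonneg _

lemma clipSq_le {r : ℝ} (hr : 0 ≤ r) (u : ℝ) : clipSq r u ≤ r ^ 2 := by
  unfold clipSq
  have : 0 ≤ min (max u 0) r := le_min (le_max_right _ _) hr
  gcongr
  exact min_le_right _ _

lemma continuous_clipSq (r : ℝ) : Continuous (clipSq r) := by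
  unfold clipSq; fun_prop

lemma measurable_clipSqDeriv (r : ℝ) : Measurable (clipSqDeriv r) := by
  unfold clipSqDeriv
  exact Measurable.ite (measurableSet_Ioo (a := 0) (b := r)) (by fun_prop) measurable_const

lemma abs_clipSqDeriv_le {r : ℝ} (hr : 0 ≤ r) (u : ℝ) : |clipSqDeriv r u| ≤ 2 * r := by
  unfold clipSqDeriv
  split_ifs with h
  · rw [abs_of_pos (by linarith)]; linarith
  · simpa using hr

lemma abs_clipSq_sub_le {r : ℝ} (hr : 0 ≤ r) (u v : ℝ) :
    |clipSq r u - clipSq r v| ≤ 2 * r * |u - v| := by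
  have h0 : ∀ w, 0 ≤ min (max w 0) r := fun w => le_min (le_max_right _ _) hr
  have h1 : ∀ w, min (max w 0) r ≤ r := fun w => min_le_right _ _
  have h2 : |min (max u 0) r - min (max v 0) r| ≤ |u - v| :=
    (abs_min_sub_min_le_max _ _ _ _).trans (by simpa using abs_max_sub_max_le_max u 0 v 0)
  rw [clipSq, clipSq, sq_sub_sq, abs_mul]
  gcongr
  rw [abs_of_nonneg (add_nonneg (h0 u) (h0 v))]
  linarith [h1 u, h1 v]

/-- Away from the kink at `r`, the function `clipSq r` is locally one of `0`, `u ^ 2`, `r ^ 2`. -/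
lemma hasDerivAt_clipSq {r u : ℝ} (hr : 0 < r) (hu : u ≠ r) :
    HasDerivAt (clipSq r) (clipSqDeriv r u) u := by
  rcases lt_trichotomy u 0 with h | h | h
  · have : clipSq r =ᶠ[𝓝 u] fun _ => 0 := by
      filter_upwards [Iio_mem_nhds h] with v hv
      have : v < 0 := hv
      rw [clipSq, max_eq_right this.le, min_eq_left hr.le]; simp
    rw [clipSqDeriv, if_neg (by grind)]
    exact (hasDerivAt_const u (0 : ℝ)).congr_of_eventuallyEq this
  · subst h
    rw [clipSqDeriv, if_neg (by simp)]
    rw [hasDerivAt_iff_isLittleO_nhds_zero]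
    refine Asymptotics.IsBigO.trans_isLittleO (g := fun h : ℝ => h ^ 2) ?_ ?_
    · refine Asymptotics.IsBigO.of_bound 1 (Eventually.of_forall fun v => ?_)
      have h0 : 0 ≤ min (max v 0) r := le_min (le_max_right _ _) hr.le
      have h1 : min (max v 0) r ≤ |v| :=
        (min_le_left _ _).trans (max_le (le_abs_self v) (abs_nonneg v))
      have h2 : clipSq r 0 = 0 := by simp [clipSq, hr.le]
      rw [zero_add, h2, smul_zero, sub_zero, sub_zero, one_mul, clipSq, Real.norm_eq_abs,
        Real.norm_eq_abs, abs_pow, abs_pow, abs_of_nonneg h0]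
      gcongr
    · simpa using Asymptotics.isLittleO_pow_id (𝕜 := ℝ) (n := 2) (by norm_num)
  · rcases lt_or_gt_of_ne hu with h' | h'
    · have : clipSq r =ᶠ[𝓝 u] fun v => v ^ 2 := by
        filter_upwards [Ioo_mem_nhds h h'] with v hv
        rw [clipSq, max_eq_left hv.1.le, min_eq_left hv.2.le]
      rw [clipSqDeriv, if_pos ⟨h, h'⟩]
      simpa using (hasDerivAt_pow 2 u).congr_of_eventuallyEq this
    · have : clipSq r =ᶠ[𝓝 u] fun _ => r ^ 2 := by
        filter_upwards [Ioi_mem_nhds h'] with v hv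
        have : r < v := hv
        rw [clipSq, max_eq_left (hr.trans this).le, min_eq_right this.le]
      rw [clipSqDeriv, if_neg (by grind)]
      exact (hasDerivAt_const u (r ^ 2)).congr_of_eventuallyEq this

lemma continuousAt_clipSqDeriv {r u : ℝ} (hu : u ≠ r) : ContinuousAt (clipSqDeriv r) u := by
  rcases lt_or_gt_of_ne hu with h' | h'
  · have : clipSqDeriv r =ᶠ[𝓝 u] fun v => 2 * max v 0 := by
      filter_upwards [Iio_mem_nhds h'] with v hv
      have : v < r := hv
      unfold clipSqDeriv
      grind
    exact ContinuousAt.congr (by fun_prop) this.symm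
  · have : clipSqDeriv r =ᶠ[𝓝 u] fun _ => 0 := by
      filter_upwards [Ioi_mem_nhds h'] with v hv
      have : r < v := hv
      rw [clipSqDeriv, if_neg (by grind)]
    exact ContinuousAt.congr continuousAt_const this.symm

/-- The linear form `(s, t) ↦ s * h - t`. -/
def affineForm (h : ℝ) : ℝ × ℝ →L[ℝ] ℝ :=
  h • ContinuousLinearMap.fst ℝ ℝ ℝ - ContinuousLinearMap.snd ℝ ℝ ℝ

lemma affineForm_apply (h : ℝ) (p : ℝ × ℝ) : affineForm h p = p.1 * h - p.2 := by
  simp [affineForm, mul_comm]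

lemma continuous_affineForm : Continuous affineForm := by
  unfold affineForm; fun_prop

lemma norm_affineForm_le (h : ℝ) : ‖affineForm h‖ ≤ |h| + 1 := by
  refine ContinuousLinearMap.opNorm_le_bound _ (by positivity) fun p => ?_
  rw [affineForm_apply, Real.norm_eq_abs]
  have h1 : |p.1| ≤ ‖p‖ := norm_fst_le p
  have h2 : |p.2| ≤ ‖p‖ := norm_snd_le p
  calc |p.1 * h - p.2| ≤ |p.1 * h| + |p.2| := abs_sub _ _
    _ = |h| * |p.1| + |p.2| := by rw [abs_mul, mul_comm]
    _ ≤ |h| * ‖p‖ + ‖p‖ := by gcongr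
    _ = (|h| + 1) * ‖p‖ := by ring

lemma integrable_id_gaussian : Integrable (fun h : ℝ => h) (gaussianReal 0 1) :=
  (memLp_id_gaussianReal (μ := 0) (v := 1) 1).integrable (by simp)

lemma ae_ne_kink (r : ℝ) {p : ℝ × ℝ} (hp : p.1 ≠ 0) :
    ∀ᵐ h ∂(gaussianReal 0 1), affineForm h p ≠ r := by
  have := nullSingletonClass_gaussianReal (μ := 0) (v := 1) one_ne_zero
  have hne : ∀ᵐ h ∂(gaussianReal 0 1), h ≠ (r + p.2) / p.1 := by
    simp [ae_iff]
  filter_upwards [hne] with h hh hk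
  rw [affineForm_apply] at hk
  exact hh (by field_simp; linarith)

/-- The derivative of `clipMoment r`. -/
def clipMomentDeriv (r : ℝ) (p : ℝ × ℝ) : ℝ × ℝ →L[ℝ] ℝ :=
  ∫ h, clipSqDeriv r (affineForm h p) • affineForm h ∂(gaussianReal 0 1)

lemma aestronglyMeasurable_clipSqDeriv_smul (r : ℝ) (p : ℝ × ℝ) :
    AEStronglyMeasurable (fun h => clipSqDeriv r (affineForm h p) • affineForm h)
      (gaussianReal 0 1) := by
  have h1 : Measurable fun h => affineForm h p := by
    simp_rw [affineForm_apply]; fun_prop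
  exact ((measurable_clipSqDeriv r).comp h1).aestronglyMeasurable.smul
    continuous_affineForm.aestronglyMeasurable

lemma integrable_clipSq {r : ℝ} (hr : 0 ≤ r) (s t : ℝ) :
    Integrable (fun h => clipSq r (s * h - t)) (gaussianReal 0 1) := by
  refine Integrable.of_bound (C := r ^ 2)
    ((continuous_clipSq r).comp (by fun_prop)).aestronglyMeasurable (ae_of_all _ fun h => ?_)
  rw [Real.norm_eq_abs, abs_of_nonneg (clipSq_nonneg _ _)]
  exact clipSq_le hr _

lemma integrable_lipschitz_bound (r : ℝ) :
    Integrable (fun h : ℝ => 2 * r * (|h| + 1)) (gaussianReal 0 1) :=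
  (integrable_id_gaussian.abs.add (integrable_const 1)).const_mul _

lemma hasFDerivAt_clipMoment {r : ℝ} (hr : 0 < r) {p : ℝ × ℝ} (hp : p.1 ≠ 0) :
    HasFDerivAt (clipMoment r) (clipMomentDeriv r p) p := by
  refine (hasFDerivAt_integral_of_dominated_loc_of_lip' (s := Set.univ)
    (F := fun (q : ℝ × ℝ) h => clipSq r (q.1 * h - q.2))
    (bound := fun h => 2 * r * (|h| + 1)) univ_mem
    (fun q _ => (integrable_clipSq hr.le q.1 q.2).aestronglyMeasurable)
    (integrable_clipSq hr.le p.1 p.2) (aestronglyMeasurable_clipSqDeriv_smul r p)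
    (ae_of_all _ fun h q _ => ?_) (integrable_lipschitz_bound r) ?_).2
  · rw [Real.norm_eq_abs]
    refine (abs_clipSq_sub_le hr.le _ _).trans ?_
    rw [← affineForm_apply, ← affineForm_apply, ← map_sub, mul_assoc (2 * r)]
    gcongr
    exact (affineForm h).le_of_opNorm_le (norm_affineForm_le h) _
  · filter_upwards [ae_ne_kink r hp] with h hh
    have := (hasDerivAt_clipSq hr hh).comp_hasFDerivAt p (affineForm h).hasFDerivAt
    simpa [Function.comp_def, affineForm_apply] using this

lemma continuousAt_clipMomentDeriv {r : ℝ} (hr : 0 < r) {p : ℝ × ℝ} (hp : p.1 ≠ 0) :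
    ContinuousAt (clipMomentDeriv r) p := by
  refine continuousAt_of_dominated (bound := fun h => 2 * r * (|h| + 1))
    (Eventually.of_forall fun q => aestronglyMeasurable_clipSqDeriv_smul r q)
    (Eventually.of_forall fun q => ae_of_all _ fun h => ?_) (integrable_lipschitz_bound r) ?_
  · rw [norm_smul]
    gcongr
    · exact abs_clipSqDeriv_le hr.le _
    · exact norm_affineForm_le h
  · filter_upwards [ae_ne_kink r hp] with h hh
    exact (ContinuousAt.comp (f := fun q => affineForm h q) (continuousAt_clipSqDeriv hh)
      (affineForm h).continuous.continuousAt).smul continuousAt_const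

lemma contDiffAt_clipMoment {r : ℝ} (hr : 0 < r) {p : ℝ × ℝ} (hp : p.1 ≠ 0) :
    ContDiffAt ℝ 1 (clipMoment r) p := by
  rw [contDiffAt_one_iff]
  refine ⟨clipMomentDeriv r, {q | q.1 ≠ 0}, ?_, ?_, ?_⟩
  · exact (isOpen_ne_fun continuous_fst continuous_const).mem_nhds hp
  · exact fun q hq => (continuousAt_clipMomentDeriv hr hq).continuousWithinAt
  · exact fun q hq => hasFDerivAt_clipMoment hr hq

lemma gaussExp_prox_sq (P s : ℝ) {t : ℝ} (ht : 0 ≤ t) :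
    gaussExp (fun h => prox P (s * h) t ^ 2) = 2 * clipMoment √P (s, t) := by
  have hr := Real.sqrt_nonneg P
  have hneg : ∫ h, clipSq √P (-(s * h) - t) ∂(gaussianReal 0 1) = clipMoment √P (s, t) := by
    have hmap := integral_map (μ := gaussianReal 0 1) (φ := fun x : ℝ => -x)
      (f := fun h => clipSq √P (s * h - t)) (by fun_prop)
      ((continuous_clipSq _).comp (by fun_prop)).aestronglyMeasurable
    rw [gaussianReal_map_neg, neg_zero] at hmap
    simpa [clipMoment] using hmap.symm
  have hintegrable : Integrable (fun h => clipSq √P (-(s * h) - t)) (gaussianReal 0 1) := by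
    simpa using integrable_clipSq hr (-s) t
  unfold gaussExp
  simp_rw [prox_sq P _ ht]
  rw [integral_add (integrable_clipSq hr s t) hintegrable, hneg, clipMoment]
  ring

lemma tauTilde_pos {lam2 τ β : ℝ} (hl2 : 0 ≤ lam2) (hτ : 0 < τ) (hβ : 0 < β) :
    0 < tauTilde lam2 τ β := by
  unfold tauTilde; positivity

/-- The right-hand side of the fixed-point equation at `q = (β, τ)`, divided by `τ ^ 2`. -/
def noiseRatio (ρ P lam1 lam2 : ℝ) (q : ℝ × ℝ) : ℝ :=
  (ρ + 2 * clipMoment √P (tauTilde lam2 q.2 q.1, lam1 * tauTilde lam2 q.2 q.1 / q.1)) / q.2 ^ 2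

section

variable {δ ρ P lam1 lam2 β τ : ℝ}

lemma threshold_nonneg (hl1 : 0 ≤ lam1) (hl2 : 0 ≤ lam2) (hβ : 0 < β) (hτ : 0 < τ) :
    0 ≤ lam1 * tauTilde lam2 τ β / β := by
  have := tauTilde_pos hl2 hτ hβ
  positivity

lemma noiseRatio_eq (hl1 : 0 ≤ lam1) (hl2 : 0 ≤ lam2) (hβ : 0 < β) (hτ : 0 < τ) :
    noiseRatio ρ P lam1 lam2 (β, τ) = (ρ + gaussExp (fun h =>
      prox P (tauTilde lam2 τ β * h) (lam1 * tauTilde lam2 τ β / β) ^ 2)) / τ ^ 2 := by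
  rw [gaussExp_prox_sq P _ (threshold_nonneg hl1 hl2 hβ hτ), noiseRatio]

lemma fixedPoint_iff_noiseRatio (hl1 : 0 ≤ lam1) (hl2 : 0 ≤ lam2) (hβ : 0 < β) (hτ : 0 < τ) :
    τ ^ 2 * δ = ρ + gaussExp (fun h =>
      prox P (tauTilde lam2 τ β * h) (lam1 * tauTilde lam2 τ β / β) ^ 2) ↔
    noiseRatio ρ P lam1 lam2 (β, τ) = δ := by
  rw [noiseRatio_eq hl1 hl2 hβ hτ, div_eq_iff (by positivity), mul_comm, eq_comm]

lemma contDiffAt_noiseRatio (ρ lam1 : ℝ) (hP : 0 < P) (hl2 : 0 ≤ lam2) (hβ : 0 < β)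
    (hτ : 0 < τ) : ContDiffAt ℝ 1 (noiseRatio ρ P lam1 lam2) (β, τ) := by
  have hT : ContDiffAt ℝ 1 (fun q : ℝ × ℝ => tauTilde lam2 q.2 q.1) (β, τ) := by
    unfold tauTilde
    have h1 : (β, τ).2 ≠ 0 := hτ.ne'
    have h2 : (β, τ).1 ≠ 0 := hβ.ne'
    have h3 : 1 / (β, τ).2 + 2 * lam2 / (β, τ).1 ≠ 0 := by
      have : 0 < 1 / τ + 2 * lam2 / β := by positivity
      exact this.ne'
    exact contDiffAt_const.div ((contDiffAt_const.div contDiffAt_snd h1).add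
      (contDiffAt_const.div contDiffAt_fst h2)) h3
  have hpair : ContDiffAt ℝ 1 (fun q : ℝ × ℝ =>
      (tauTilde lam2 q.2 q.1, lam1 * tauTilde lam2 q.2 q.1 / q.1)) (β, τ) :=
    hT.prodMk ((contDiffAt_const.mul hT).div contDiffAt_fst hβ.ne')
  have hM : ContDiffAt ℝ 1 (fun q : ℝ × ℝ => clipMoment √P
      (tauTilde lam2 q.2 q.1, lam1 * tauTilde lam2 q.2 q.1 / q.1)) (β, τ) :=
    (contDiffAt_clipMoment (Real.sqrt_pos.2 hP) (tauTilde_pos hl2 hτ hβ).ne').comp (β, τ) hpair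
  exact (contDiffAt_const.add (contDiffAt_const.mul hM)).div (contDiffAt_snd.pow 2)
    (pow_ne_zero 2 hτ.ne')

lemma contDiffAt_noiseRatio_right (ρ lam1 : ℝ) (hP : 0 < P) (hl2 : 0 ≤ lam2) (hβ : 0 < β)
    (hτ : 0 < τ) : ContDiffAt ℝ 1 (fun x => noiseRatio ρ P lam1 lam2 (β, x)) τ :=
  (contDiffAt_noiseRatio ρ lam1 hP hl2 hβ hτ).comp τ (contDiffAt_const.prodMk contDiffAt_id)

lemma integrable_prox_sq (P s : ℝ) {t : ℝ} (ht : 0 ≤ t) :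
    Integrable (fun h => prox P (s * h) t ^ 2) (gaussianReal 0 1) := by
  refine Integrable.of_bound (C := √P ^ 2)
    (((measurable_prox P t).comp (measurable_const_mul s)).pow_const 2).aestronglyMeasurable
    (ae_of_all _ fun h => ?_)
  rw [norm_pow]
  gcongr
  exact abs_prox_le P _ ht

lemma tauTilde_div_antitone {τ' : ℝ} (hl2 : 0 ≤ lam2) (hβ : 0 < β) (hτ : 0 < τ) (h : τ ≤ τ') :
    tauTilde lam2 τ' β / τ' ≤ tauTilde lam2 τ β / τ := by
  have hτ' := hτ.trans_le h
  have key : ∀ x, 0 < x → tauTilde lam2 x β / x = 1 / (1 + 2 * lam2 * x / β) := by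
    intro x hx
    unfold tauTilde
    field_simp
  rw [key τ hτ, key τ' hτ']
  gcongr

/-- Dividing by `τ`, the proximal point shrinks as `τ` grows. -/
lemma abs_prox_div_antitone {τ' : ℝ} (hl1 : 0 ≤ lam1) (hl2 : 0 ≤ lam2) (hβ : 0 < β)
    (hτ : 0 < τ) (h : τ ≤ τ') (y : ℝ) :
    |prox P (tauTilde lam2 τ' β * y) (lam1 * tauTilde lam2 τ' β / β)| / τ' ≤
      |prox P (tauTilde lam2 τ β * y) (lam1 * tauTilde lam2 τ β / β)| / τ := by
  have hτ' := hτ.trans_le h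
  have key : ∀ x, 0 < x →
      |prox P (tauTilde lam2 x β * y) (lam1 * tauTilde lam2 x β / β)| / x =
        min (tauTilde lam2 x β / x * max (|y| - lam1 / β) 0) (√P / x) := by
    intro x hx
    have hs := tauTilde_pos hl2 hx hβ
    rw [abs_prox P _ (threshold_nonneg hl1 hl2 hβ hx), abs_mul, abs_of_pos hs,
      show tauTilde lam2 x β * |y| - lam1 * tauTilde lam2 x β / β
        = tauTilde lam2 x β * (|y| - lam1 / β) by ring,
      show max (tauTilde lam2 x β * (|y| - lam1 / β)) 0
        = tauTilde lam2 x β * max (|y| - lam1 / β) 0 by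
          rw [mul_max_of_nonneg _ _ hs.le, mul_zero],
      ← min_div_div_right hx.le, mul_div_right_comm]
  rw [key τ hτ, key τ' hτ']
  have := tauTilde_div_antitone hl2 hβ hτ h
  gcongr

lemma noiseRatio_sub_antitone {τ' : ℝ} (hl1 : 0 ≤ lam1) (hl2 : 0 ≤ lam2)
    (hβ : 0 < β) (hτ : 0 < τ) (h : τ ≤ τ') :
    noiseRatio ρ P lam1 lam2 (β, τ') - ρ / τ' ^ 2 ≤
      noiseRatio ρ P lam1 lam2 (β, τ) - ρ / τ ^ 2 := by
  have hτ' := hτ.trans_le h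
  rw [noiseRatio_eq hl1 hl2 hβ hτ, noiseRatio_eq hl1 hl2 hβ hτ', add_div, add_div,
    add_sub_cancel_left, add_sub_cancel_left, gaussExp, gaussExp, ← integral_div, ← integral_div]
  refine integral_mono
    ((integrable_prox_sq P _ (threshold_nonneg hl1 hl2 hβ hτ')).div_const _)
    ((integrable_prox_sq P _ (threshold_nonneg hl1 hl2 hβ hτ)).div_const _) fun y => ?_
  have := abs_prox_div_antitone (P := P) hl1 hl2 hβ hτ h y
  simp only [← div_pow]
  rw [← sq_abs, ← sq_abs (_ / τ), abs_div, abs_div, abs_of_pos hτ, abs_of_pos hτ']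
  gcongr

lemma noiseRatio_strictAnti {τ' : ℝ} (hρ : 0 < ρ) (hl1 : 0 ≤ lam1) (hl2 : 0 ≤ lam2)
    (hβ : 0 < β) (hτ : 0 < τ) (h : τ < τ') :
    noiseRatio ρ P lam1 lam2 (β, τ') < noiseRatio ρ P lam1 lam2 (β, τ) := by
  have h1 := noiseRatio_sub_antitone (ρ := ρ) (P := P) hl1 hl2 hβ hτ h.le
  have h2 : ρ / τ' ^ 2 < ρ / τ ^ 2 := by gcongr
  linarith

lemma deriv_noiseRatio_neg (hρ : 0 < ρ) (hP : 0 < P) (hl1 : 0 ≤ lam1) (hl2 : 0 ≤ lam2)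
    (hβ : 0 < β) (hτ : 0 < τ) :
    deriv (fun x => noiseRatio ρ P lam1 lam2 (β, x)) τ < 0 := by
  have hd : HasDerivAt (fun x => noiseRatio ρ P lam1 lam2 (β, x)) _ τ :=
    ((contDiffAt_noiseRatio_right ρ lam1 hP hl2 hβ hτ).differentiableAt one_ne_zero).hasDerivAt
  have hq : HasDerivAt (fun x : ℝ => ρ / x ^ 2) (-(2 * ρ / τ ^ 3)) τ := by
    have := (hasDerivAt_const τ ρ).div (hasDerivAt_pow 2 τ) (pow_ne_zero 2 hτ.ne')
    refine this.congr_deriv ?_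
    simp
    field_simp
  have hanti : AntitoneOn (fun x => noiseRatio ρ P lam1 lam2 (β, x) - ρ / x ^ 2)
      (Set.Ioi 0) := fun x hx y _ hxy => noiseRatio_sub_antitone hl1 hl2 hβ hx hxy
  have hle := hanti.derivWithin_nonpos (x := τ)
  rw [derivWithin_of_isOpen isOpen_Ioi hτ, (hd.fun_sub hq).deriv] at hle
  have : 0 < 2 * ρ / τ ^ 3 := by positivity
  linarith

lemma noiseRatio_bounds (hP : 0 < P) (hl1 : 0 ≤ lam1) (hl2 : 0 ≤ lam2)
    (hβ : 0 < β) (hτ : 0 < τ) :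
    ρ / τ ^ 2 ≤ noiseRatio ρ P lam1 lam2 (β, τ) ∧
      noiseRatio ρ P lam1 lam2 (β, τ) ≤ (ρ + P) / τ ^ 2 := by
  have ht := threshold_nonneg hl1 hl2 hβ hτ
  have h0 : 0 ≤ gaussExp (fun h =>
      prox P (tauTilde lam2 τ β * h) (lam1 * tauTilde lam2 τ β / β) ^ 2) :=
    integral_nonneg fun _ => sq_nonneg _
  have h1 : gaussExp (fun h =>
      prox P (tauTilde lam2 τ β * h) (lam1 * tauTilde lam2 τ β / β) ^ 2) ≤ P := by
    have := integral_mono (integrable_prox_sq P (tauTilde lam2 τ β) ht)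
      (integrable_const P) (fun h => by
        have := abs_prox_le P (tauTilde lam2 τ β * h) ht
        rw [← sq_abs]
        calc _ ≤ √P ^ 2 := by gcongr
          _ = P := Real.sq_sqrt hP.le)
    simpa [gaussExp] using this
  rw [noiseRatio_eq hl1 hl2 hβ hτ]
  constructor <;> gcongr
  linarith

lemma exists_noiseRatio_eq (hδ : 0 < δ) (hρ : 0 < ρ) (hP : 0 < P) (hl1 : 0 ≤ lam1)
    (hl2 : 0 ≤ lam2) (hβ : 0 < β) :
    ∃ τ, 0 < τ ∧ noiseRatio ρ P lam1 lam2 (β, τ) = δ := by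
  have ha : 0 < √(ρ / δ) := Real.sqrt_pos.2 (by positivity)
  have hb : 0 < √((ρ + P) / δ) := Real.sqrt_pos.2 (by positivity)
  have hab : √(ρ / δ) ≤ √((ρ + P) / δ) := Real.sqrt_le_sqrt (by gcongr; linarith)
  have hcont : ContinuousOn (fun x => noiseRatio ρ P lam1 lam2 (β, x))
      (Set.Icc √(ρ / δ) √((ρ + P) / δ)) := fun x hx =>
    (contDiffAt_noiseRatio_right ρ lam1 hP hl2 hβ
      (ha.trans_le hx.1)).continuousAt.continuousWithinAt
  have h1 := (noiseRatio_bounds (ρ := ρ) hP hl1 hl2 hβ ha).1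
  have h2 := (noiseRatio_bounds (ρ := ρ) hP hl1 hl2 hβ hb).2
  rw [Real.sq_sqrt (by positivity), div_div_cancel₀ (by positivity)] at h1 h2
  obtain ⟨τ, hτ, hτδ⟩ := intermediate_value_Icc' hab hcont ⟨h2, h1⟩
  exact ⟨τ, ha.trans_le hτ.1, hτδ⟩

/-- An envelope theorem: if the increments of `f` are bounded above by the increments of `g`
weighted by a continuous multiplier `m`, then `f` is differentiable wherever `g` is. -/
lemma hasDerivAt_of_increment_le {f g m : ℝ → ℝ} {s : Set ℝ} {x g' : ℝ} (hs : s ∈ 𝓝 x)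
    (hle : ∀ y ∈ s, ∀ z ∈ s, f y ≤ f z + (g y - g z) * m z)
    (hm : ContinuousAt m x) (hg : HasDerivAt g g' x) :
    HasDerivAt f (g' * m x) x := by
  have hx := mem_of_mem_nhds hs
  have hfirst : (fun y => f y - f x - (g y - g x) * m x) =o[𝓝 x] fun y => y - x := by
    have hprod : (fun y => (g y - g x) * (m y - m x)) =o[𝓝 x] fun y => (y - x) * 1 := by
      refine hg.differentiableAt.isBigO_sub.mul_isLittleO ?_
      rw [Asymptotics.isLittleO_one_iff]
      exact tendsto_sub_nhds_zero_iff.2 hm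
    simp only [mul_one] at hprod
    refine Asymptotics.IsBigO.trans_isLittleO (Asymptotics.IsBigO.of_bound 1 ?_) hprod
    filter_upwards [hs] with y hy
    have h1 := hle y hy x hx
    have h2 := hle x hx y hy
    rw [one_mul, Real.norm_eq_abs, Real.norm_eq_abs, abs_of_nonpos (by linarith),
      abs_of_nonpos (by linarith)]
    linarith
  rw [hasDerivAt_iff_isLittleO] at hg ⊢
  refine (hfirst.add (hg.const_mul_left (m x))).congr_left fun y => ?_
  simp only [smul_eq_mul]
  ring

/-- The objective of the inner minimization in `psi`. -/
def innerObjective (lam1 lam2 β τ h x : ℝ) : ℝ :=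
  β / (2 * τ) * x ^ 2 + lam2 * x ^ 2 - β * h * x + lam1 * |x|

lemma innerObjective_eq (hl2 : 0 ≤ lam2) (hβ : 0 < β) (hτ : 0 < τ) (h x : ℝ) :
    innerObjective lam1 lam2 β τ h x = β / tauTilde lam2 τ β *
      (x ^ 2 / 2 - tauTilde lam2 τ β * h * x + lam1 * tauTilde lam2 τ β / β * |x|) := by
  have hs := tauTilde_pos hl2 hτ hβ
  have hinv : β / tauTilde lam2 τ β = β / τ + 2 * lam2 := by
    unfold tauTilde
    field_simp
  have h1 : β / tauTilde lam2 τ β *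
      (x ^ 2 / 2 - tauTilde lam2 τ β * h * x + lam1 * tauTilde lam2 τ β / β * |x|)
      = β / tauTilde lam2 τ β * (x ^ 2 / 2) - β * h * x + lam1 * |x| := by
    field_simp
  rw [h1, hinv, innerObjective]
  field_simp

/-- The minimizer of `innerObjective` over `|x| ≤ √P`. -/
def innerArgmin (P lam1 lam2 β τ h : ℝ) : ℝ :=
  prox P (tauTilde lam2 τ β * h) (lam1 * tauTilde lam2 τ β / β)

lemma innerObjective_innerArgmin_le (hl1 : 0 ≤ lam1) (hl2 : 0 ≤ lam2) (hβ : 0 < β)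
    (hτ : 0 < τ) (h : ℝ) {x : ℝ} (hx : |x| ≤ √P) :
    innerObjective lam1 lam2 β τ h (innerArgmin P lam1 lam2 β τ h) ≤
      innerObjective lam1 lam2 β τ h x := by
  have hs := tauTilde_pos hl2 hτ hβ
  rw [innerObjective_eq hl2 hβ hτ, innerObjective_eq hl2 hβ hτ]
  exact mul_le_mul_of_nonneg_left (prox_le P _ (threshold_nonneg hl1 hl2 hβ hτ) hx)
    (by positivity)

lemma abs_innerArgmin_le (hl1 : 0 ≤ lam1) (hl2 : 0 ≤ lam2) (hβ : 0 < β) (hτ : 0 < τ) (h : ℝ) :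
    |innerArgmin P lam1 lam2 β τ h| ≤ √P :=
  abs_prox_le P _ (threshold_nonneg hl1 hl2 hβ hτ)

lemma sInf_innerObjective (hl1 : 0 ≤ lam1) (hl2 : 0 ≤ lam2) (hβ : 0 < β) (hτ : 0 < τ) (h : ℝ) :
    sInf ((fun x => β / (2 * τ) * x ^ 2 + lam2 * x ^ 2 - β * h * x + lam1 * |x|) ''
      Set.Icc (-√P) √P) =
    innerObjective lam1 lam2 β τ h (innerArgmin P lam1 lam2 β τ h) := by
  refine IsLeast.csInf_eq ⟨⟨_, abs_le.1 (abs_innerArgmin_le hl1 hl2 hβ hτ h), rfl⟩, ?_⟩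
  rintro _ ⟨x, hx, rfl⟩
  exact innerObjective_innerArgmin_le hl1 hl2 hβ hτ h (abs_le.2 hx)

lemma integrable_innerObjective (hl1 : 0 ≤ lam1) (hl2 : 0 ≤ lam2) (hβ : 0 < β) (hτ : 0 < τ) :
    Integrable (fun h => innerObjective lam1 lam2 β τ h (innerArgmin P lam1 lam2 β τ h))
      (gaussianReal 0 1) := by
  have hmeas : Measurable (innerArgmin P lam1 lam2 β τ) :=
    (measurable_prox P _).comp (measurable_const_mul _)
  have hbd : ∀ᵐ h ∂(gaussianReal 0 1), ‖innerArgmin P lam1 lam2 β τ h‖ ≤ √P :=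
    ae_of_all _ fun h => abs_innerArgmin_le hl1 hl2 hβ hτ h
  have h1 : Integrable (innerArgmin P lam1 lam2 β τ) (gaussianReal 0 1) :=
    Integrable.of_bound hmeas.aestronglyMeasurable _ hbd
  have h2 : Integrable (fun h => innerArgmin P lam1 lam2 β τ h ^ 2) (gaussianReal 0 1) :=
    integrable_prox_sq P _ (threshold_nonneg hl1 hl2 hβ hτ)
  have h3 : Integrable (fun h => β * h * innerArgmin P lam1 lam2 β τ h) (gaussianReal 0 1) :=
    (integrable_id_gaussian.const_mul β).mul_bdd hmeas.aestronglyMeasurable hbd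
  exact (((h2.const_mul _).add (h2.const_mul _)).sub h3).add (h1.abs.const_mul _)

/-- The expected inner minimum appearing in `psi`. -/
def expectedInnerMin (P lam1 lam2 β τ : ℝ) : ℝ :=
  gaussExp fun h => innerObjective lam1 lam2 β τ h (innerArgmin P lam1 lam2 β τ h)

lemma expectedInnerMin_le {τ' : ℝ} (hl1 : 0 ≤ lam1) (hl2 : 0 ≤ lam2) (hβ : 0 < β)
    (hτ : 0 < τ) (hτ' : 0 < τ') :
    expectedInnerMin P lam1 lam2 β τ ≤ expectedInnerMin P lam1 lam2 β τ' +
      (β / (2 * τ) - β / (2 * τ')) * gaussExp fun h => innerArgmin P lam1 lam2 β τ' h ^ 2 := by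
  have h2 : Integrable (fun h => innerArgmin P lam1 lam2 β τ' h ^ 2) (gaussianReal 0 1) :=
    integrable_prox_sq P _ (threshold_nonneg hl1 hl2 hβ hτ')
  have h1 := integrable_innerObjective (P := P) hl1 hl2 hβ hτ'
  unfold expectedInnerMin gaussExp
  rw [← integral_const_mul, ← integral_add h1 (h2.const_mul _)]
  refine integral_mono (integrable_innerObjective hl1 hl2 hβ hτ) (h1.add (h2.const_mul _))
    fun h => ?_
  refine (innerObjective_innerArgmin_le hl1 hl2 hβ hτ h
    (abs_innerArgmin_le hl1 hl2 hβ hτ' h)).trans (le_of_eq ?_)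
  simp only [innerObjective]
  ring

lemma hasDerivAt_psi (δ ρ : ℝ) (hP : 0 < P) (hl1 : 0 ≤ lam1) (hl2 : 0 ≤ lam2) (hβ : 0 < β)
    (hτ : 0 < τ) :
    HasDerivAt (fun x => psi δ ρ P lam1 lam2 x β)
      (β / 2 * (δ - noiseRatio ρ P lam1 lam2 (β, τ))) τ := by
  have hg : HasDerivAt (fun x : ℝ => β / (2 * x)) (-(β / (2 * τ ^ 2))) τ := by
    have := (hasDerivAt_const τ β).div ((hasDerivAt_id τ).const_mul 2)
      (mul_ne_zero two_ne_zero hτ.ne')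
    refine this.congr_deriv ?_
    simp
    field_simp
  have hmoment : ∀ x, 0 < x → gaussExp (fun h => innerArgmin P lam1 lam2 β x h ^ 2) =
      noiseRatio ρ P lam1 lam2 (β, x) * x ^ 2 - ρ := by
    intro x hx
    rw [noiseRatio_eq hl1 hl2 hβ hx, div_mul_cancel₀ _ (by positivity), add_sub_cancel_left]
    rfl
  have hm : ContinuousAt (fun x => gaussExp fun h => innerArgmin P lam1 lam2 β x h ^ 2) τ := by
    have hc := (contDiffAt_noiseRatio_right ρ lam1 hP hl2 hβ hτ).continuousAt
    refine ((hc.mul (continuousAt_id.pow 2)).sub (continuousAt_const (y := ρ))).congr ?_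
    filter_upwards [Ioi_mem_nhds hτ] with x hx
    exact (hmoment x hx).symm
  have henv := hasDerivAt_of_increment_le (Ioi_mem_nhds hτ)
    (fun y hy z hz => expectedInnerMin_le (P := P) hl1 hl2 hβ hy hz) hm hg
  have hlin : HasDerivAt (fun x : ℝ => β * x * δ / 2 - β ^ 2 / 4) (β * δ / 2) τ := by
    simpa using ((((hasDerivAt_id τ).const_mul β).mul_const δ).div_const 2).sub_const (β ^ 2 / 4)
  have hsum := (hlin.add (hg.mul_const ρ)).add henv
  refine (hsum.congr_deriv ?_).congr_of_eventuallyEq ?_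
  · rw [hmoment τ hτ]
    field_simp
    ring
  · filter_upwards [Ioi_mem_nhds hτ] with x hx
    simp only [psi, Pi.add_apply, expectedInnerMin, sInf_innerObjective hl1 hl2 hβ hx]
    ring

lemma psi_lt_of_ne {τ' : ℝ} (hρ : 0 < ρ) (hP : 0 < P) (hl1 : 0 ≤ lam1) (hl2 : 0 ≤ lam2)
    (hβ : 0 < β) (hτ : 0 < τ) (hsol : noiseRatio ρ P lam1 lam2 (β, τ) = δ)
    (hτ' : 0 < τ') (hne : τ' ≠ τ) :
    psi δ ρ P lam1 lam2 τ β < psi δ ρ P lam1 lam2 τ' β := by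
  have hd : ∀ x, 0 < x → HasDerivAt (fun x => psi δ ρ P lam1 lam2 x β)
      (β / 2 * (δ - noiseRatio ρ P lam1 lam2 (β, x))) x :=
    fun x hx => hasDerivAt_psi δ ρ hP hl1 hl2 hβ hx
  rcases lt_or_gt_of_ne hne with h | h
  · refine strictAntiOn_of_deriv_neg (convex_Icc τ' τ)
      (fun x hx => (hd x (hτ'.trans_le hx.1)).continuousAt.continuousWithinAt) (fun x hx => ?_)
      (Set.left_mem_Icc.2 h.le) (Set.right_mem_Icc.2 h.le) h
    rw [interior_Icc] at hx
    have hx0 := hτ'.trans hx.1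
    rw [(hd x hx0).deriv]
    have := noiseRatio_strictAnti (P := P) hρ hl1 hl2 hβ hx0 hx.2
    exact mul_neg_of_pos_of_neg (by positivity) (by linarith)
  · refine strictMonoOn_of_deriv_pos (convex_Icc τ τ')
      (fun x hx => (hd x (hτ.trans_le hx.1)).continuousAt.continuousWithinAt) (fun x hx => ?_)
      (Set.left_mem_Icc.2 h.le) (Set.right_mem_Icc.2 h.le) h
    rw [interior_Icc] at hx
    rw [(hd x (hτ.trans hx.1)).deriv]
    have := noiseRatio_strictAnti (P := P) hρ hl1 hl2 hβ hτ hx.1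
    exact mul_pos (by positivity) (by linarith)

lemma isInvertible_fderiv_noiseRatio_comp_inr (hρ : 0 < ρ) (hP : 0 < P) (hl1 : 0 ≤ lam1)
    (hl2 : 0 ≤ lam2) (hβ : 0 < β) (hτ : 0 < τ) :
    (fderiv ℝ (noiseRatio ρ P lam1 lam2) (β, τ) ∘L .inr ℝ ℝ ℝ).IsInvertible := by
  have hd := ((contDiffAt_noiseRatio ρ lam1 hP hl2 hβ hτ).differentiableAt one_ne_zero).hasFDerivAt
  have hpartial : HasFDerivAt (fun x => noiseRatio ρ P lam1 lam2 (β, x))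
      (fderiv ℝ (noiseRatio ρ P lam1 lam2) (β, τ) ∘L .inr ℝ ℝ ℝ) τ :=
    hd.comp τ (hasFDerivAt_prodMk_right β τ)
  have hne := (deriv_noiseRatio_neg hρ hP hl1 hl2 hβ hτ).ne
  rw [hpartial.hasDerivAt.deriv] at hne
  set A := fderiv ℝ (noiseRatio ρ P lam1 lam2) (β, τ) ∘L .inr ℝ ℝ ℝ
  refine ⟨ContinuousLinearEquiv.unitsEquivAut ℝ (Units.mk0 (A 1) hne), ?_⟩
  ext
  simp

lemma contDiffAt_of_noiseRatio_eq {T : ℝ → ℝ} (hρ : 0 < ρ) (hP : 0 < P) (hl1 : 0 ≤ lam1)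
    (hl2 : 0 ≤ lam2) (hT : ∀ β, 0 < β → 0 < T β ∧ noiseRatio ρ P lam1 lam2 (β, T β) = δ)
    (hβ : 0 < β) : ContDiffAt ℝ 1 T β := by
  have hτ := (hT β hβ).1
  have hcd := contDiffAt_noiseRatio (P := P) ρ lam1 hP hl2 hβ hτ
  have hinv := isInvertible_fderiv_noiseRatio_comp_inr hρ hP hl1 hl2 hβ hτ
  have hφ := hcd.contDiffAt_implicitFunction one_ne_zero hinv
  have hself := hcd.implicitFunction_apply_self one_ne_zero hinv
  have hsol := hcd.eventually_apply_implicitFunction one_ne_zero hinv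
  set φ := hcd.implicitFunction one_ne_zero hinv
  have hpos : ∀ᶠ x in 𝓝 β, 0 < φ x :=
    hφ.continuousAt.eventually (by rw [hself]; exact lt_mem_nhds hτ)
  refine hφ.congr_of_eventuallyEq ?_
  filter_upwards [hpos, hsol, lt_mem_nhds hβ] with x hx hxs hx0
  obtain ⟨hTx, hTs⟩ := hT x hx0
  rw [(hT β hβ).2, ← hTs] at hxs
  rcases lt_trichotomy (T x) (φ x) with h | h | h
  · exact absurd hxs (noiseRatio_strictAnti hρ hl1 hl2 hx0 hTx h).ne
  · exact h
  · exact absurd hxs (noiseRatio_strictAnti hρ hl1 hl2 hx0 hx h).ne'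

end

theorem unique_tau_star_of_beta
    (δ ρ P lam1 lam2 : ℝ) (hδ : 0 < δ) (hρ : 0 < ρ) (hP : 0 < P)
    (hl1 : 0 ≤ lam1) (hl2 : 0 ≤ lam2) :
    ∃ T : ℝ → ℝ,
      (∀ β : ℝ, 0 < β →
        -- `T β` is the unique strictly positive solution of the first fixed-point equation
        (0 < T β ∧
          (T β) ^ 2 * δ = ρ + gaussExp (fun h =>
            (prox P (tauTilde lam2 (T β) β * h) (lam1 * tauTilde lam2 (T β) β / β)) ^ 2) ∧
          (∀ τ : ℝ, 0 < τ →
            τ ^ 2 * δ = ρ + gaussExp (fun h =>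
              (prox P (tauTilde lam2 τ β * h) (lam1 * tauTilde lam2 τ β / β)) ^ 2) →
            τ = T β)) ∧
        -- `T β` is the unique minimizer of `τ ↦ ψ(τ, β)`
        ((∀ τ : ℝ, 0 < τ → psi δ ρ P lam1 lam2 (T β) β ≤ psi δ ρ P lam1 lam2 τ β) ∧
          (∀ τ : ℝ, 0 < τ →
            (∀ τ' : ℝ, 0 < τ' → psi δ ρ P lam1 lam2 τ β ≤ psi δ ρ P lam1 lam2 τ' β) →
            τ = T β))) ∧
      -- the map `β ↦ τ*(β)` is continuously differentiable on `(0, ∞)`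
      ContDiffOn ℝ 1 T (Set.Ioi 0) := by
  have hex : ∀ β : ℝ, ∃ τ, 0 < β → 0 < τ ∧ noiseRatio ρ P lam1 lam2 (β, τ) = δ := by
    intro β
    by_cases hβ : 0 < β
    · obtain ⟨τ, hτ⟩ := exists_noiseRatio_eq hδ hρ hP hl1 hl2 hβ
      exact ⟨τ, fun _ => hτ⟩
    · exact ⟨0, fun h => absurd h hβ⟩
  choose T hT using hex
  refine ⟨T, fun β hβ => ?_, fun β hβ =>
    (contDiffAt_of_noiseRatio_eq hρ hP hl1 hl2 hT hβ).contDiffWithinAt⟩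
  obtain ⟨hpos, hsol⟩ := hT β hβ
  have hlt : ∀ τ, 0 < τ → τ ≠ T β → psi δ ρ P lam1 lam2 (T β) β < psi δ ρ P lam1 lam2 τ β :=
    fun τ hτ hne => psi_lt_of_ne hρ hP hl1 hl2 hβ hpos hsol hτ hne
  refine ⟨⟨hpos, (fixedPoint_iff_noiseRatio hl1 hl2 hβ hpos).2 hsol, fun τ hτ heq => ?_⟩,
    fun τ hτ => ?_, fun τ hτ hmin => ?_⟩
  · rw [fixedPoint_iff_noiseRatio hl1 hl2 hβ hτ, ← hsol] at heq
    rcases lt_trichotomy τ (T β) with h | h | h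
    · exact absurd heq (noiseRatio_strictAnti hρ hl1 hl2 hβ hτ h).ne'
    · exact h
    · exact absurd heq (noiseRatio_strictAnti hρ hl1 hl2 hβ hpos h).ne
  · rcases eq_or_ne τ (T β) with h | h
    · rw [h]
    · exact (hlt τ hτ h).le
  · by_contra h
    exact absurd (hmin (T β) hpos) (hlt τ hτ h).not_ge

end
end

section
/- There exist strictly positive constants τ_min, τ_max, β_min, β_max that depend only on P, δ, ρ, λ₁ and λ₂ such that τ_min ≤ (τ*)²δ − ρ ≤ τ_max and β_min ≤ β* ≤ β_max, where (τ*, β*) is the unique strictly positive solution of the fixed-point system. -/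
open MeasureTheory ProbabilityTheory Real Filter Topology

noncomputable section

/-- The box-clipped soft threshold `min (√P, (a|h| - t)₊)`, which is the modulus of
`prox P (a * h) t`. -/
def clippedSoft (P a t h : ℝ) : ℝ := min (√P) (max (a * |h| - t) 0)

lemma clippedSoft_nonneg (P a t h : ℝ) : 0 ≤ clippedSoft P a t h :=
  le_min (Real.sqrt_nonneg P) (le_max_right _ _)

lemma clippedSoft_le_sqrt (P a t h : ℝ) : clippedSoft P a t h ≤ √P := min_le_left _ _

lemma continuous_clippedSoft (P a t : ℝ) : Continuous (clippedSoft P a t) := by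
  unfold clippedSoft
  fun_prop

lemma prox_of_nonneg {P y t : ℝ} (ht : 0 ≤ t) (hy : 0 ≤ y) :
    prox P y t = min (√P) (max (y - t) 0) := by
  have hs := Real.sqrt_nonneg P
  unfold prox
  grind

lemma prox_neg {P y t : ℝ} (ht : 0 ≤ t) : prox P (-y) t = -prox P y t := by
  have hs := Real.sqrt_nonneg P
  unfold prox
  grind

lemma prox_sq_eq {P a t : ℝ} (ha : 0 ≤ a) (ht : 0 ≤ t) (h : ℝ) :
    prox P (a * h) t ^ 2 = clippedSoft P a t h ^ 2 := by
  unfold clippedSoft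
  rcases abs_cases h with ⟨h1, h2⟩ | ⟨h1, h2⟩
  · rw [h1, prox_of_nonneg ht (mul_nonneg ha h2)]
  · rw [h1, ← prox_of_nonneg ht (mul_nonneg ha (by linarith)), mul_neg, prox_neg ht, neg_sq]

lemma mul_prox_eq {P a t : ℝ} (ha : 0 ≤ a) (ht : 0 ≤ t) (h : ℝ) :
    h * prox P (a * h) t = |h| * clippedSoft P a t h := by
  unfold clippedSoft
  rcases abs_cases h with ⟨h1, h2⟩ | ⟨h1, h2⟩
  · rw [h1, prox_of_nonneg ht (mul_nonneg ha h2)]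
  · rw [h1, ← prox_of_nonneg ht (mul_nonneg ha (by linarith)), mul_neg, prox_neg ht, neg_mul_neg]

lemma integrable_sq_gaussianReal : Integrable (fun h : ℝ => h ^ 2) (gaussianReal 0 1) :=
  (memLp_id_gaussianReal 2).integrable_sq

lemma integral_sq_gaussianReal : ∫ h : ℝ, h ^ 2 ∂(gaussianReal 0 1) = 1 := by
  have h1 := variance_fun_id_gaussianReal (μ := 0) (v := 1)
  rw [variance_of_integral_eq_zero (by fun_prop) integral_id_gaussianReal] at h1
  simpa using h1

lemma integrable_abs_gaussianReal : Integrable (fun h : ℝ => |h|) (gaussianReal 0 1) :=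
  ((memLp_id_gaussianReal 1).integrable le_rfl).abs

instance isOpenPosMeasure_gaussianReal : (gaussianReal 0 1).IsOpenPosMeasure :=
  (gaussianReal_absolutelyContinuous' 0 one_ne_zero).isOpenPosMeasure

lemma integrable_clippedSoft_sq (P a t : ℝ) :
    Integrable (fun h => clippedSoft P a t h ^ 2) (gaussianReal 0 1) := by
  refine Integrable.of_bound ((continuous_clippedSoft P a t).pow 2).aestronglyMeasurable
    (√P ^ 2) (ae_of_all _ fun h => ?_)
  rw [Real.norm_of_nonneg (sq_nonneg _)]
  exact pow_le_pow_left₀ (clippedSoft_nonneg ..) (clippedSoft_le_sqrt ..) 2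

lemma integrable_abs_mul_clippedSoft (P a t : ℝ) :
    Integrable (fun h => |h| * clippedSoft P a t h) (gaussianReal 0 1) := by
  refine (integrable_abs_gaussianReal.mul_const (√P)).mono'
    (continuous_abs.mul (continuous_clippedSoft P a t)).aestronglyMeasurable
    (ae_of_all _ fun h => ?_)
  rw [Real.norm_of_nonneg (mul_nonneg (abs_nonneg h) (clippedSoft_nonneg ..))]
  exact mul_le_mul_of_nonneg_left (clippedSoft_le_sqrt ..) (abs_nonneg h)

lemma integral_clippedSoft_sq_le {P : ℝ} (hP : 0 ≤ P) (a t : ℝ) :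
    ∫ h, clippedSoft P a t h ^ 2 ∂(gaussianReal 0 1) ≤ P := by
  have h := integral_mono (integrable_clippedSoft_sq P a t) (integrable_const P) fun h => by
    have := pow_le_pow_left₀ (clippedSoft_nonneg P a t h) (clippedSoft_le_sqrt P a t h) 2
    rwa [Real.sq_sqrt hP] at this
  simpa using h

lemma integral_clippedSoft_sq_pos {P a : ℝ} (hP : 0 < P) (ha : 0 < a) (t : ℝ) :
    0 < ∫ h, clippedSoft P a t h ^ 2 ∂(gaussianReal 0 1) := by
  refine integral_pos_of_integrable_nonneg_nonzero (x := (|t| + 1) / a)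
    ((continuous_clippedSoft P a t).pow 2) (integrable_clippedSoft_sq P a t) (fun h => sq_nonneg _)
    (pow_ne_zero 2 (ne_of_gt (lt_min (Real.sqrt_pos.2 hP) (lt_max_of_lt_left ?_))))
  rw [abs_of_pos (by positivity), mul_div_cancel₀ _ ha.ne']
  linarith [le_abs_self t]

lemma integral_abs_mul_clippedSoft_nonneg (P a t : ℝ) :
    0 ≤ ∫ h, |h| * clippedSoft P a t h ∂(gaussianReal 0 1) :=
  integral_nonneg fun h => mul_nonneg (abs_nonneg h) (clippedSoft_nonneg ..)

lemma integral_abs_mul_clippedSoft_le {P a t c : ℝ}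
    (hc : ∀ h, |h| * clippedSoft P a t h ≤ c * h ^ 2) :
    ∫ h, |h| * clippedSoft P a t h ∂(gaussianReal 0 1) ≤ c := by
  have h := integral_mono (integrable_abs_mul_clippedSoft P a t)
    (integrable_sq_gaussianReal.const_mul c) hc
  rwa [integral_const_mul, integral_sq_gaussianReal, mul_one] at h

lemma abs_mul_clippedSoft_le_mul_sq {P a t : ℝ} (ha : 0 ≤ a) (ht : 0 ≤ t) (h : ℝ) :
    |h| * clippedSoft P a t h ≤ a * h ^ 2 := by
  have h1 : clippedSoft P a t h ≤ a * |h| :=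
    (min_le_right _ _).trans (max_le (by linarith) (by positivity))
  nlinarith [mul_le_mul_of_nonneg_left h1 (abs_nonneg h), sq_abs h]

lemma abs_mul_clippedSoft_le_sqrt_mul_sq {P a s : ℝ} (ha : 0 ≤ a) (hs : 0 < s) (h : ℝ) :
    |h| * clippedSoft P a (s * a) h ≤ √P / s * h ^ 2 := by
  have hP := Real.sqrt_nonneg P
  rcases le_total |h| s with hle | hle
  · have h0 : clippedSoft P a (s * a) h ≤ 0 :=
      (min_le_right _ _).trans (max_le (by nlinarith) le_rfl)
    exact (mul_nonpos_of_nonneg_of_nonpos (abs_nonneg h) h0).trans (by positivity)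
  · rw [div_mul_eq_mul_div, le_div_iff₀ hs, ← sq_abs h]
    calc |h| * clippedSoft P a (s * a) h * s ≤ |h| * √P * |h| := by
          have := clippedSoft_le_sqrt P a (s * a) h
          have := clippedSoft_nonneg P a (s * a) h
          gcongr
      _ = √P * |h| ^ 2 := by ring

/-- The gap `E[h² a - |h| min (√P, a|h|)]` between the Gaussian correlations of the identity and
of its clipping. -/
def clipGap (P a : ℝ) : ℝ :=
  ∫ h, (a * h ^ 2 - |h| * clippedSoft P a 0 h) ∂(gaussianReal 0 1)

lemma integrable_clipGap (P a : ℝ) :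
    Integrable (fun h => a * h ^ 2 - |h| * clippedSoft P a 0 h) (gaussianReal 0 1) :=
  (integrable_sq_gaussianReal.const_mul a).sub (integrable_abs_mul_clippedSoft P a 0)

lemma clipGap_eq (P a : ℝ) :
    clipGap P a = a - ∫ h, |h| * clippedSoft P a 0 h ∂(gaussianReal 0 1) := by
  rw [clipGap, integral_sub (integrable_sq_gaussianReal.const_mul a)
    (integrable_abs_mul_clippedSoft P a 0), integral_const_mul, integral_sq_gaussianReal, mul_one]

lemma clipGap_mono {P a b : ℝ} (ha : 0 ≤ a) (hab : a ≤ b) : clipGap P a ≤ clipGap P b := by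
  refine integral_mono (integrable_clipGap P a) (integrable_clipGap P b) fun h => ?_
  have h0 := abs_nonneg h
  have hmul : a * |h| ≤ b * |h| := by gcongr
  have h1 : clippedSoft P b 0 h - clippedSoft P a 0 h ≤ b * |h| - a * |h| := by
    have : 0 ≤ a * |h| := by positivity
    unfold clippedSoft
    grind
  have h2 := mul_le_mul_of_nonneg_left h1 h0
  have h3 := sq_abs h
  simp only
  nlinarith

lemma clipGap_pos {P a : ℝ} (ha : 0 < a) : 0 < clipGap P a := by
  have hcont : Continuous fun h => a * h ^ 2 - |h| * clippedSoft P a 0 h :=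
    (continuous_const.mul (continuous_pow 2)).sub
      (continuous_abs.mul (continuous_clippedSoft P a 0))
  refine integral_pos_of_integrable_nonneg_nonzero (x := (√P + 1) / a) hcont
    (integrable_clipGap P a)
    (fun h => sub_nonneg.2 (abs_mul_clippedSoft_le_mul_sq ha.le le_rfl h)) (ne_of_gt ?_)
  have hx : 0 < (√P + 1) / a := by positivity
  have h1 := mul_le_mul_of_nonneg_left (clippedSoft_le_sqrt P a 0 ((√P + 1) / a)) hx.le
  have h2 : a * ((√P + 1) / a) ^ 2 = ((√P + 1) / a) * (√P + 1) := by field_simp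
  rw [abs_of_pos hx, h2]
  linarith

lemma clippedSoft_mul_mono {P a b s r : ℝ} (ha : 0 ≤ a) (hab : a ≤ b) (hsr : s ≤ r) (h : ℝ) :
    clippedSoft P a (r * a) h ≤ clippedSoft P b (s * b) h := by
  have key : max (a * |h| - r * a) 0 ≤ max (b * |h| - s * b) 0 := by
    rcases le_total |h| r with hle | hle
    · exact max_le ((by nlinarith : a * |h| - r * a ≤ 0).trans (le_max_right _ _))
        (le_max_right _ _)
    · refine max_le_max ?_ le_rfl
      nlinarith [mul_le_mul hab (by linarith : |h| - r ≤ |h| - s) (by linarith) (ha.trans hab)]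
  exact min_le_min le_rfl key

lemma tauTilde_mono {lam2 τ β τ' β' : ℝ} (hl2 : 0 ≤ lam2) (hτ : 0 < τ) (hβ : 0 < β)
    (hτ' : τ ≤ τ') (hβ' : β ≤ β') : tauTilde lam2 τ β ≤ tauTilde lam2 τ' β' := by
  unfold tauTilde
  have := hτ.trans_le hτ'
  have := hβ.trans_le hβ'
  gcongr

lemma tauTilde_le {lam2 τ β : ℝ} (hl2 : 0 < lam2) (hτ : 0 < τ) (hβ : 0 < β) :
    tauTilde lam2 τ β ≤ β / (2 * lam2) := by
  unfold tauTilde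
  rw [← one_div_div (2 * lam2) β]
  gcongr
  linarith [one_div_pos.2 hτ]

lemma FixedPoint.sq_mul_eq {δ ρ P lam1 lam2 τ β : ℝ} (hl1 : 0 ≤ lam1) (hl2 : 0 ≤ lam2)
    (hτ : 0 < τ) (hβ : 0 < β) (h : FixedPoint δ ρ P lam1 lam2 τ β) :
    τ ^ 2 * δ = ρ + ∫ x, clippedSoft P (tauTilde lam2 τ β)
      (lam1 / β * tauTilde lam2 τ β) x ^ 2 ∂(gaussianReal 0 1) := by
  have ha := (tauTilde_pos hl2 hτ hβ).le
  have h1 := h.1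
  simp only [gaussExp, mul_div_right_comm lam1,
    prox_sq_eq ha (mul_nonneg (div_nonneg hl1 hβ.le) ha)] at h1
  exact h1

lemma FixedPoint.eq_sub {δ ρ P lam1 lam2 τ β : ℝ} (hl1 : 0 ≤ lam1) (hl2 : 0 ≤ lam2)
    (hτ : 0 < τ) (hβ : 0 < β) (h : FixedPoint δ ρ P lam1 lam2 τ β) :
    β = 2 * τ * δ - 2 * ∫ x, |x| * clippedSoft P (tauTilde lam2 τ β)
      (lam1 / β * tauTilde lam2 τ β) x ∂(gaussianReal 0 1) := by
  have ha := (tauTilde_pos hl2 hτ hβ).le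
  have h1 := h.2
  simp only [gaussExp, mul_div_right_comm lam1,
    mul_prox_eq ha (mul_nonneg (div_nonneg hl1 hβ.le) ha)] at h1
  exact h1

lemma FixedPoint.sqrt_le {δ ρ P lam1 lam2 τ β : ℝ} (hδ : 0 < δ) (hl1 : 0 ≤ lam1)
    (hl2 : 0 ≤ lam2) (hτ : 0 < τ) (hβ : 0 < β) (h : FixedPoint δ ρ P lam1 lam2 τ β) :
    √(ρ / δ) ≤ τ := by
  rw [Real.sqrt_le_left hτ.le, div_le_iff₀ hδ, h.sq_mul_eq hl1 hl2 hτ hβ]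
  exact le_add_of_nonneg_right (integral_nonneg fun x => sq_nonneg _)

lemma FixedPoint.le_sqrt {δ ρ P lam1 lam2 τ β : ℝ} (hδ : 0 < δ) (hP : 0 ≤ P) (hl1 : 0 ≤ lam1)
    (hl2 : 0 ≤ lam2) (hτ : 0 < τ) (hβ : 0 < β) (h : FixedPoint δ ρ P lam1 lam2 τ β) :
    τ ≤ √((ρ + P) / δ) := by
  apply Real.le_sqrt_of_sq_le
  rw [le_div_iff₀ hδ, h.sq_mul_eq hl1 hl2 hτ hβ]
  gcongr
  exact integral_clippedSoft_sq_le hP _ _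

lemma FixedPoint.exists_pos_le {δ ρ P lam1 lam2 : ℝ} (hδ : 0 < δ) (hρ : 0 < ρ)
    (hl1 : 0 ≤ lam1) (hl2 : 0 ≤ lam2)
    (hcase : 0 < max lam1 lam2 ∨ (lam1 = 0 ∧ lam2 = 0 ∧ 1 ≤ δ)) :
    ∃ b : ℝ, 0 < b ∧ ∀ τ β : ℝ, 0 < τ → 0 < β → FixedPoint δ ρ P lam1 lam2 τ β → b ≤ β := by
  have hτ0 : 0 < √(ρ / δ) := Real.sqrt_pos.2 (div_pos hρ hδ)
  rcases hcase with hmax | ⟨rfl, rfl, hδ1⟩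
  · rcases lt_max_iff.1 hmax with h1 | h2
    · refine ⟨2 * √(ρ / δ) * δ / (1 + 2 * (√P / lam1)), by positivity, fun τ β hτ hβ h => ?_⟩
      have hle := h.sqrt_le hδ hl1 hl2 hτ hβ
      have hint := integral_abs_mul_clippedSoft_le (abs_mul_clippedSoft_le_sqrt_mul_sq (P := P)
        (tauTilde_pos hl2 hτ hβ).le (div_pos h1 hβ))
      have heq := h.eq_sub hl1 hl2 hτ hβ
      have hdiv : √P / (lam1 / β) = √P / lam1 * β := by field_simp
      rw [hdiv] at hint
      rw [div_le_iff₀ (by positivity)]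
      nlinarith
    · refine ⟨2 * √(ρ / δ) * δ / (1 + 1 / lam2), by positivity, fun τ β hτ hβ h => ?_⟩
      have hle := h.sqrt_le hδ hl1 hl2 hτ hβ
      have ha := (tauTilde_pos hl2 hτ hβ).le
      have hint := (integral_abs_mul_clippedSoft_le (abs_mul_clippedSoft_le_mul_sq (P := P)
        ha (mul_nonneg (div_nonneg hl1 hβ.le) ha))).trans (tauTilde_le h2 hτ hβ)
      have heq := h.eq_sub hl1 hl2 hτ hβ
      have hdiv : β / (2 * lam2) = 1 / lam2 * β / 2 := by field_simp
      rw [hdiv] at hint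
      rw [div_le_iff₀ (by positivity)]
      nlinarith
  · refine ⟨2 * clipGap P (√(ρ / δ)), mul_pos two_pos (clipGap_pos hτ0), fun τ β hτ hβ h => ?_⟩
    have hmono := clipGap_mono (P := P) hτ0.le (h.sqrt_le hδ hl1 hl2 hτ hβ)
    have heq := h.eq_sub hl1 hl2 hτ hβ
    have htilde : tauTilde 0 τ β = τ := by simp [tauTilde]
    rw [htilde, zero_div, zero_mul] at heq
    rw [clipGap_eq P τ] at hmono
    nlinarith

theorem fixed_point_bounds
    (δ ρ P lam1 lam2 : ℝ) (hδ : 0 < δ) (hρ : 0 < ρ) (hP : 0 < P)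
    (hl1 : 0 ≤ lam1) (hl2 : 0 ≤ lam2)
    (hcase : 0 < max lam1 lam2 ∨ (lam1 = 0 ∧ lam2 = 0 ∧ 1 ≤ δ)) :
    ∃ τmin τmax βmin βmax : ℝ,
      0 < τmin ∧ 0 < τmax ∧ 0 < βmin ∧ 0 < βmax ∧
      ∀ τs βs : ℝ, 0 < τs → 0 < βs → FixedPoint δ ρ P lam1 lam2 τs βs →
        τmin ≤ τs ^ 2 * δ - ρ ∧ τs ^ 2 * δ - ρ ≤ τmax ∧
        βmin ≤ βs ∧ βs ≤ βmax := by
  obtain ⟨b, hb, hbβ⟩ := FixedPoint.exists_pos_le (P := P) hδ hρ hl1 hl2 hcase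
  have hτ0 : 0 < √(ρ / δ) := Real.sqrt_pos.2 (div_pos hρ hδ)
  have ha := tauTilde_pos hl2 hτ0 hb
  refine ⟨∫ x, clippedSoft P (tauTilde lam2 (√(ρ / δ)) b)
      (lam1 / b * tauTilde lam2 (√(ρ / δ)) b) x ^ 2 ∂(gaussianReal 0 1), P, b,
    2 * √((ρ + P) / δ) * δ, integral_clippedSoft_sq_pos hP ha _, hP, hb, by positivity,
    fun τ β hτ hβ h => ?_⟩
  have hble := hbβ τ β hτ hβ h
  rw [h.sq_mul_eq hl1 hl2 hτ hβ, add_sub_cancel_left]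
  refine ⟨?_, integral_clippedSoft_sq_le hP.le _ _, hble, ?_⟩
  · refine integral_mono (integrable_clippedSoft_sq ..) (integrable_clippedSoft_sq ..) fun x => ?_
    refine pow_le_pow_left₀ (clippedSoft_nonneg ..) (clippedSoft_mul_mono ha.le ?_ ?_ x) 2
    · exact tauTilde_mono hl2 hτ0 hb (h.sqrt_le hδ hl1 hl2 hτ hβ) hble
    · gcongr
  · have hτle := h.le_sqrt hδ hP.le hl1 hl2 hτ hβ
    have heq := h.eq_sub hl1 hl2 hτ hβ
    have hnn := integral_abs_mul_clippedSoft_nonneg P (tauTilde lam2 τ β)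
      (lam1 / β * tauTilde lam2 τ β)
    nlinarith

end
end
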